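/- Let P, Q, R, S be n×n complex matrices with PQ = QP = PS = SQ = QR = RP = 0 and SP = SR = 0. Let l, m, n be positive integers with l ≥ max(ind(S), ind(Q)), m ≥ max(ind(R), ind(P)), and n ≥ max(ind(S+Q), ind(P^π(R+P))). Then the Drazin inverse of (S+Q) + P^π(R+P) is: ((S+Q)+P^π(R+P))^d = Σ_{j=0}^{n−1} P^π·( Σ_{k=1}^{j} P^k R^{j−k} + R^π R^j − Σ_{i=0}^{m−1} P^{i+1}(R^d)^{i+1} R^j )·( Q^π·Σ_{h=0}^{l−1} Q^h (S^d)^{h+j+1} − Σ_{k=1}^{j} (Q^d)^k (S^d)^{j+1−k} + Σ_{h=0}^{l−1} (Q^d)^{h+j+1} S^h S^π ) + Σ_{j=0}^{n−1} Σ_{i=0}^{m−1} P^π P^i (R^d)^{i+j+1}·( Σ_{k=0}^{j} Q^k S^{j−k} S^π − Q^π·Σ_{h=0}^{l−1} Q^{h+1+j}(S^d)^{h+1} − Σ_{h=0}^{l−1} Q^{j+1}(Q^d)^{h+1} S^h S^π ), where empty sums (lower limit exceeding upper limit) are 0. -/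

import Mathlib

open Matrix Finset

/-- `X` is the Drazin inverse of `A`: `A X = X A`, `X A X = X`, and
`A^(k+1) X = A^k` for some (hence all sufficiently large) `k`. -/
def IsDrazinInverse {ι : Type*} [Fintype ι] [DecidableEq ι]
    (A X : Matrix ι ι ℂ) : Prop :=
  A * X = X * A ∧ X * A * X = X ∧ ∃ k : ℕ, A ^ (k + 1) * X = A ^ k

section Ring
variable {R : Type*} [Ring R]

theorem mul_pow_add_two_of_outer {a x : R} (hc : a * x = x * a) (ho : x * a * x = x) (j : ℕ) :
    a * x ^ (j + 2) = x ^ (j + 1) := by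
  have h : a * x * x = x := by rw [hc, ho]
  rw [pow_succ' x (j + 1), pow_succ' x j, ← mul_assoc, ← mul_assoc, h]

theorem pow_add_two_mul_of_outer {a x : R} (hc : a * x = x * a) (ho : x * a * x = x) (j : ℕ) :
    x ^ (j + 2) * a = x ^ (j + 1) := by
  have h : Commute a x := hc
  rw [← (h.pow_right (j + 2)).eq, mul_pow_add_two_of_outer hc ho]

theorem outer_mul_eq_zero {a x b : R} (hc : a * x = x * a) (ho : x * a * x = x) (h : a * b = 0) :
    x * b = 0 := by
  rw [← ho, mul_assoc x, hc, mul_assoc, mul_assoc, h, mul_zero, mul_zero]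

theorem mul_outer_eq_zero {a x b : R} (hc : a * x = x * a) (ho : x * a * x = x) (h : b * a = 0) :
    b * x = 0 := by
  rw [← ho, ← hc, ← mul_assoc, ← mul_assoc, h, zero_mul, zero_mul]

/-- The powers of a sum `a + b` with `a * b = 0`. -/
theorem add_pow_of_mul_eq_zero {a b : R} (h : a * b = 0) (k : ℕ) :
    (a + b) ^ k = ∑ i ∈ range (k + 1), b ^ i * a ^ (k - i) := by
  induction k with
  | zero => simp
  | succ k ih =>
    have h1 : (∑ i ∈ range (k + 1), b ^ i * a ^ (k - i)) * b = b ^ (k + 1) := by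
      rw [sum_range_succ, add_mul, sum_mul, sum_eq_zero, zero_add]
      · simp [pow_succ]
      · intro i hi
        have hi' : k - i = (k - i - 1) + 1 := by have := mem_range.1 hi; omega
        rw [hi', pow_succ, mul_assoc, mul_assoc, h, mul_zero, mul_zero]
    have h2 : (∑ i ∈ range (k + 1), b ^ i * a ^ (k - i)) * a
        = ∑ i ∈ range (k + 1), b ^ i * a ^ (k + 1 - i) := by
      rw [sum_mul]
      refine sum_congr rfl fun i hi => ?_
      have hi' : k + 1 - i = (k - i) + 1 := by have := mem_range.1 hi; omega
      rw [hi', pow_succ, mul_assoc]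
    rw [pow_succ, ih, mul_add, h1, h2, sum_range_succ _ (k + 1)]
    simp

theorem mul_drazin_sum_of_mul_eq_zero {c b x y z : R} (hcb : c * b = 0) (hcy : c * y = 0)
    (a : R) (N j : ℕ) :
    c * ((1 - b * y) * ∑ h ∈ range (N + 1), b ^ h * x ^ (h + j + 1)
      + ∑ h ∈ range (N + 1), y ^ (h + j + 1) * a ^ h * z) = c * x ^ (j + 1) := by
  have e1 : c * ((1 - b * y) * ∑ h ∈ range (N + 1), b ^ h * x ^ (h + j + 1)) = c * x ^ (j + 1) := by
    rw [← mul_assoc, mul_sub, mul_one, ← mul_assoc, hcb, zero_mul, sub_zero, sum_range_succ',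
      mul_add, mul_sum, sum_eq_zero]
    · simp
    · intro h _
      rw [pow_succ' b, ← mul_assoc, ← mul_assoc, hcb, zero_mul, zero_mul]
  have e2 : c * ∑ h ∈ range (N + 1), y ^ (h + j + 1) * a ^ h * z = 0 := by
    rw [mul_sum]
    refine sum_eq_zero fun h _ => ?_
    rw [pow_succ' y, ← mul_assoc, ← mul_assoc, ← mul_assoc, hcy]
    simp
  rw [mul_add, e1, e2, add_zero]

/-- The spectral idempotent of `a + b` when `a * b = 0`. -/
theorem add_mul_drazin_sum {a b x y : R} (hab : a * b = 0) (hay : a * y = 0)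
    (hby : b * y = y * b) (hyo : y * b * y = y)
    (N : ℕ) (hbN : b ^ (N + 1) * (1 - b * y) = 0) :
    (a + b) * ((1 - b * y) * ∑ j ∈ range (N + 1), b ^ j * x ^ (j + 1)
      + ∑ j ∈ range (N + 1), y ^ (j + 1) * a ^ j * (1 - a * x))
    = a * x + b * y * (1 - a * x) + (1 - b * y) * ∑ j ∈ range N, b ^ (j + 1) * x ^ (j + 1)
      + ∑ j ∈ range N, y ^ (j + 1) * a ^ (j + 1) * (1 - a * x) := by
  have hcb : Commute b y := hby
  have hcp : ∀ k, Commute (b ^ k) (1 - b * y) := fun k =>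
    (Commute.one_right _).sub_right (((Commute.refl b).mul_right hcb).pow_left k)
  have e1 := mul_drazin_sum_of_mul_eq_zero (x := x) (z := 1 - a * x) hab hay a N 0
  simp only [add_zero, zero_add, pow_one] at e1
  have e3 : b * ((1 - b * y) * ∑ j ∈ range (N + 1), b ^ j * x ^ (j + 1))
      = (1 - b * y) * ∑ j ∈ range N, b ^ (j + 1) * x ^ (j + 1) := by
    have := (hcp 1).eq
    rw [pow_one] at this
    rw [← mul_assoc, this, mul_assoc, mul_sum, sum_range_succ, mul_add, ← mul_assoc b, ← pow_succ',
      ← mul_assoc _ (b ^ (N + 1)), ← (hcp _).eq, hbN, zero_mul, add_zero]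
    simp_rw [← mul_assoc, ← pow_succ']
  have e4 : b * ∑ j ∈ range (N + 1), y ^ (j + 1) * a ^ j * (1 - a * x)
      = b * y * (1 - a * x) + ∑ j ∈ range N, y ^ (j + 1) * a ^ (j + 1) * (1 - a * x) := by
    rw [sum_range_succ', mul_add, mul_sum, add_comm]
    congr 1
    · simp [mul_assoc]
    · refine sum_congr rfl fun j _ => ?_
      rw [← mul_assoc, ← mul_assoc, mul_pow_add_two_of_outer hby hyo]
  rw [add_mul, e1, mul_add, e3, e4]
  abel

theorem drazin_sum_mul_add {a b x y : R} (hab : a * b = 0) (hxb : x * b = 0)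
    (hax : a * x = x * a) (hxo : x * a * x = x) (hby : b * y = y * b)
    (N : ℕ) (haN : a ^ (N + 1) * (1 - a * x) = 0) :
    ((1 - b * y) * ∑ j ∈ range (N + 1), b ^ j * x ^ (j + 1)
      + ∑ j ∈ range (N + 1), y ^ (j + 1) * a ^ j * (1 - a * x)) * (a + b)
    = a * x + b * y * (1 - a * x) + (1 - b * y) * ∑ j ∈ range N, b ^ (j + 1) * x ^ (j + 1)
      + ∑ j ∈ range N, y ^ (j + 1) * a ^ (j + 1) * (1 - a * x) := by
  have hpa : (1 - a * x) * a = a * (1 - a * x) := by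
    rw [sub_mul, mul_sub, one_mul, mul_one, mul_assoc, ← hax]
  have hpb : (1 - a * x) * b = b := by rw [sub_mul, one_mul, mul_assoc, hxb, mul_zero, sub_zero]
  have e1 : ((1 - b * y) * ∑ j ∈ range (N + 1), b ^ j * x ^ (j + 1)) * b = 0 := by
    rw [mul_assoc, sum_mul, sum_eq_zero, mul_zero]
    intro j _
    rw [pow_succ x, mul_assoc, mul_assoc, hxb, mul_zero, mul_zero]
  have e2 : (∑ j ∈ range (N + 1), y ^ (j + 1) * a ^ j * (1 - a * x)) * b = b * y := by
    rw [sum_mul, sum_range_succ', sum_eq_zero, zero_add]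
    · rw [mul_assoc, hpb, hby]; simp
    · intro j _
      rw [mul_assoc, hpb, mul_assoc, pow_succ a, mul_assoc, hab, mul_zero, mul_zero]
  have e3 : ((1 - b * y) * ∑ j ∈ range (N + 1), b ^ j * x ^ (j + 1)) * a
      = (1 - b * y) * (a * x) + (1 - b * y) * ∑ j ∈ range N, b ^ (j + 1) * x ^ (j + 1) := by
    rw [mul_assoc, sum_mul, sum_range_succ', mul_add, add_comm]
    congr 1
    · simp [hax]
    · refine congrArg _ (sum_congr rfl fun j _ => ?_)
      rw [mul_assoc, pow_add_two_mul_of_outer hax hxo]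
  have e4 : (∑ j ∈ range (N + 1), y ^ (j + 1) * a ^ j * (1 - a * x)) * a
      = ∑ j ∈ range N, y ^ (j + 1) * a ^ (j + 1) * (1 - a * x) := by
    have h : ∀ j, y ^ (j + 1) * a ^ j * (1 - a * x) * a
        = y ^ (j + 1) * (a ^ (j + 1) * (1 - a * x)) := fun j => by
      rw [mul_assoc, hpa, pow_succ a, mul_assoc, mul_assoc]
    rw [sum_mul, sum_congr rfl fun j _ => h j, sum_range_succ, haN, mul_zero, add_zero]
    simp_rw [mul_assoc]
  rw [mul_add, add_mul, add_mul, e1, e2, e3, e4]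
  noncomm_ring

theorem drazin_sum_idempotent_mul {a b x y : R} (hab : a * b = 0) (hay : a * y = 0)
    (hax : a * x = x * a) (hxo : x * a * x = x) (hby : b * y = y * b) (hyo : y * b * y = y)
    (N : ℕ) :
    (a * x + b * y * (1 - a * x) + (1 - b * y) * ∑ j ∈ range N, b ^ (j + 1) * x ^ (j + 1)
      + ∑ j ∈ range N, y ^ (j + 1) * a ^ (j + 1) * (1 - a * x)) *
      ((1 - b * y) * ∑ j ∈ range (N + 1), b ^ j * x ^ (j + 1)
      + ∑ j ∈ range (N + 1), y ^ (j + 1) * a ^ j * (1 - a * x))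
    = (1 - b * y) * ∑ j ∈ range (N + 1), b ^ j * x ^ (j + 1)
      + ∑ j ∈ range (N + 1), y ^ (j + 1) * a ^ j * (1 - a * x) := by
  have hpa : (1 - a * x) * a = a * (1 - a * x) := by
    rw [sub_mul, mul_sub, one_mul, mul_one, mul_assoc, ← hax]
  have hpx : (1 - a * x) * x = 0 := by rw [sub_mul, one_mul, hax, hxo, sub_self]
  have hpax : (1 - a * x) * (a * x) = 0 := by rw [← mul_assoc, hpa, mul_assoc, hpx, mul_zero]
  set X1 := (1 - b * y) * ∑ j ∈ range (N + 1), b ^ j * x ^ (j + 1) with hX1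
  set X2 := ∑ j ∈ range (N + 1), y ^ (j + 1) * a ^ j * (1 - a * x) with hX2
  have e1 : a * (X1 + X2) = a * x := by
    have := mul_drazin_sum_of_mul_eq_zero (x := x) (z := 1 - a * x) hab hay a N 0
    simpa only [add_zero, zero_add, pow_one] using this
  have e2 : a * x * (X1 + X2) = x := by rw [hax, mul_assoc, e1, ← mul_assoc, hxo]
  have e3 : b * y * X1 = 0 := by
    have : b * y * (b * y) = b * y := by rw [mul_assoc, ← mul_assoc y, hyo]
    rw [hX1, ← mul_assoc, mul_sub, mul_one, this, sub_self, zero_mul]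
  have e4 : b * y * X2 = X2 := by
    rw [hX2, mul_sum]
    refine sum_congr rfl fun j _ => ?_
    rw [pow_succ' y, ← mul_assoc, ← mul_assoc, ← mul_assoc, hby, hyo]
  have e5 : ((1 - b * y) * ∑ j ∈ range N, b ^ (j + 1) * x ^ (j + 1)) * (X1 + X2)
      = X1 - (1 - b * y) * x := by
    have h : ∀ j, b ^ (j + 1) * x ^ (j + 1) * (X1 + X2) = b ^ (j + 1) * x ^ (j + 1 + 1) := by
      intro j
      have hx : x * (X1 + X2) = x * x := by
        conv_lhs => rw [← hxo]
        rw [mul_assoc, mul_assoc, ← mul_assoc a, e2]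
      rw [mul_assoc, pow_succ x j, mul_assoc _ x, hx, pow_succ x (j + 1), pow_succ x j, mul_assoc]
    rw [mul_assoc, sum_mul, sum_congr rfl fun j _ => h j, hX1, sum_range_succ']
    simp [mul_add]
  have e6 : (∑ j ∈ range N, y ^ (j + 1) * a ^ (j + 1) * (1 - a * x)) * (X1 + X2) = 0 := by
    rw [sum_mul]
    refine sum_eq_zero fun j _ => ?_
    rw [pow_succ a, mul_assoc, mul_assoc, mul_assoc (a ^ j), ← mul_assoc a, ← hpa, mul_assoc, e1, hpax,
      mul_zero, mul_zero]
  have e7 : b * y * (1 - a * x) * (X1 + X2) = X2 - b * y * x := by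
    rw [mul_assoc, sub_mul, e2, one_mul, mul_sub, mul_add, e3, e4, zero_add]
  rw [add_mul, add_mul, add_mul, e2, e5, e6, e7]
  noncomm_ring

theorem pow_mul_pow_of_drazin {b y : R} {n : ℕ}
    (hbn : b ^ n * (1 - b * y) = 0) (j i : ℕ) (hi : n ≤ i) : b ^ (i + j) * y ^ j = b ^ i := by
  have h : ∀ i, n ≤ i → b ^ i * (b * y) = b ^ i := fun i hi => by
    have : b ^ i * (1 - b * y) = 0 := by
      rw [← Nat.sub_add_cancel hi, pow_add, mul_assoc, hbn, mul_zero]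
    rw [mul_sub, mul_one, sub_eq_zero] at this
    exact this.symm
  induction j with
  | zero => simp
  | succ j ih =>
    rw [← add_assoc, pow_succ b, pow_succ' y, mul_assoc, ← mul_assoc b, ← mul_assoc, h _ (by omega),
      ih]

theorem add_pow_mul_drazin_sum {a b x y : R} (hab : a * b = 0) (hay : a * y = 0)
    (N : ℕ) (hbN : b ^ (N + 1) * (1 - b * y) = 0) (haN : a ^ (N + 1) * (1 - a * x) = 0) :
    (a + b) ^ (2 * N + 2) * (a * x + b * y * (1 - a * x)
      + (1 - b * y) * ∑ j ∈ range N, b ^ (j + 1) * x ^ (j + 1)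
      + ∑ j ∈ range N, y ^ (j + 1) * a ^ (j + 1) * (1 - a * x)) = (a + b) ^ (2 * N + 2) := by
  set Z := a * x + b * y * (1 - a * x)
      + (1 - b * y) * ∑ j ∈ range N, b ^ (j + 1) * x ^ (j + 1)
      + ∑ j ∈ range N, y ^ (j + 1) * a ^ (j + 1) * (1 - a * x) with hZ
  have hpow : ∀ k, N + 1 ≤ k → a ^ k * (1 - a * x) = 0 := fun k hk => by
    rw [← Nat.sub_add_cancel hk, pow_add, mul_assoc, haN, mul_zero]
  have hbpow : ∀ k, N + 1 ≤ k → b ^ k * (1 - b * y) = 0 := fun k hk => by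
    rw [← Nat.sub_add_cancel hk, pow_add, mul_assoc, hbN, mul_zero]
  have e1 : a * (1 - Z) = a * (1 - a * x) := by
    have h1 : a * ((1 - b * y) * ∑ j ∈ range N, b ^ (j + 1) * x ^ (j + 1)) = 0 := by
      rw [← mul_assoc, mul_sub, mul_one, ← mul_assoc, hab, zero_mul, sub_zero, mul_sum]
      refine sum_eq_zero fun j _ => ?_
      rw [pow_succ' b, ← mul_assoc, ← mul_assoc, hab, zero_mul, zero_mul]
    have h2 : a * ∑ j ∈ range N, y ^ (j + 1) * a ^ (j + 1) * (1 - a * x) = 0 := by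
      rw [mul_sum]
      refine sum_eq_zero fun j _ => ?_
      rw [pow_succ' y, ← mul_assoc, ← mul_assoc, ← mul_assoc, hay]
      simp
    have h3 : a * (b * y * (1 - a * x)) = 0 := by
      rw [← mul_assoc, ← mul_assoc, hab, zero_mul, zero_mul]
    rw [mul_sub, hZ, mul_add, mul_add, mul_add, h1, h2, h3, mul_sub]
    simp
  have e2 : b ^ (2 * N + 2) * (1 - Z)
      = - ∑ j ∈ range N, b ^ (2 * N + 1 - j) * a ^ (j + 1) * (1 - a * x) := by
    have h1 : b ^ (2 * N + 2) * ((1 - b * y) * ∑ j ∈ range N, b ^ (j + 1) * x ^ (j + 1)) = 0 := by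
      rw [← mul_assoc, hbpow _ (by omega), zero_mul]
    have h2 : b ^ (2 * N + 2) * ∑ j ∈ range N, y ^ (j + 1) * a ^ (j + 1) * (1 - a * x)
        = ∑ j ∈ range N, b ^ (2 * N + 1 - j) * a ^ (j + 1) * (1 - a * x) := by
      rw [mul_sum]
      refine sum_congr rfl fun j hj => ?_
      have hj' := mem_range.1 hj
      have : 2 * N + 2 = (2 * N + 1 - j) + (j + 1) := by omega
      rw [this, ← mul_assoc, ← mul_assoc, pow_mul_pow_of_drazin hbN _ _ (by omega)]
    have h3 : b ^ (2 * N + 2) * (b * y * (1 - a * x)) = b ^ (2 * N + 2) * (1 - a * x) := by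
      have := hbpow (2 * N + 2) (by omega)
      rw [mul_sub, mul_one, sub_eq_zero] at this
      rw [← mul_assoc, ← this]
    rw [mul_sub, hZ, mul_add, mul_add, mul_add, h1, h2, h3]
    noncomm_ring
  have e3 : (a + b) ^ (2 * N + 2) * (1 - Z) = 0 := by
    rw [add_pow_of_mul_eq_zero hab, sum_range_succ, add_mul, Nat.sub_self, pow_zero, mul_one, e2,
      add_neg_eq_zero, sum_mul]
    have h : ∀ i ∈ range (2 * N + 2), b ^ i * a ^ (2 * N + 2 - i) * (1 - Z)
        = b ^ i * a ^ (2 * N + 2 - i) * (1 - a * x) := fun i hi => by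
      have hi' : 2 * N + 2 - i = (2 * N + 1 - i) + 1 := by have := mem_range.1 hi; omega
      rw [hi', pow_succ, mul_assoc, mul_assoc _ a, e1]
      simp only [mul_assoc]
    rw [sum_congr rfl h, ← sum_range_reflect, show 2 * N + 2 = N + (N + 2) by ring,
      sum_range_add, add_eq_left.2 (sum_eq_zero fun i _ => ?_)]
    · refine sum_congr rfl fun i hi => ?_
      have := mem_range.1 hi
      congr 3
      · omega
      · omega
    · rw [mul_assoc, hpow, mul_zero]
      omega
  rw [mul_sub, mul_one, sub_eq_zero] at e3
  exact e3.symm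
theorem sum_Icc_one_eq_sum_range (f : ℕ → R) (j : ℕ) :
    ∑ k ∈ Icc 1 j, f k = ∑ k ∈ range j, f (k + 1) := by
  rw [range_eq_Ico, sum_Ico_add' f 0 j 1]
  rfl

/-- The powers of the Drazin inverse of `s + q` when `s * q = 0`. -/
theorem drazin_sum_pow {s q x y : R} (hxq : x * q = 0) (hxy : x * y = 0)
    (hsq : s * q = 0) (hsy : s * y = 0) (hsx : s * x = x * s) (hxo : x * s * x = x)
    (hyo : y * q * y = y) (N j : ℕ) :
    ((1 - q * y) * ∑ h ∈ range (N + 1), q ^ h * x ^ (h + 1)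
      + ∑ h ∈ range (N + 1), y ^ (h + 1) * s ^ h * (1 - s * x)) ^ (j + 1)
    = (1 - q * y) * (∑ h ∈ range (N + 1), q ^ h * x ^ (h + j + 1))
      - (∑ k ∈ Icc 1 j, y ^ k * x ^ (j + 1 - k))
      + ∑ h ∈ range (N + 1), y ^ (h + j + 1) * s ^ h * (1 - s * x) := by
  simp only [sum_Icc_one_eq_sum_range, Nat.add_sub_add_right]
  have hps : (1 - s * x) * s = s * (1 - s * x) := by
    rw [sub_mul, mul_sub, one_mul, mul_one, mul_assoc, ← hsx]
  have hpx : (1 - s * x) * x = 0 := by rw [sub_mul, one_mul, hsx, hxo, sub_self]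
  induction j with
  | zero => simp
  | succ j ih =>
    rw [pow_succ', ih]
    have key : ∀ c : R, c * q = 0 → c * y = 0 →
        c * ((1 - q * y) * (∑ h ∈ range (N + 1), q ^ h * x ^ (h + j + 1))
          - (∑ k ∈ range j, y ^ (k + 1) * x ^ (j - k))
          + ∑ h ∈ range (N + 1), y ^ (h + j + 1) * s ^ h * (1 - s * x)) = c * x ^ (j + 1) := by
      intro c hcq hcy
      have h0 : c * ∑ k ∈ range j, y ^ (k + 1) * x ^ (j - k) = 0 := by
        rw [mul_sum]
        refine sum_eq_zero fun k _ => ?_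
        rw [pow_succ' y, ← mul_assoc, ← mul_assoc, hcy, zero_mul, zero_mul]
      rw [← mul_drazin_sum_of_mul_eq_zero (x := x) (z := 1 - s * x) hcq hcy s N j, sub_add_eq_add_sub,
        mul_sub, h0, sub_zero]
    have hyT : y * ((1 - q * y) * (∑ h ∈ range (N + 1), q ^ h * x ^ (h + j + 1))
          - (∑ k ∈ range j, y ^ (k + 1) * x ^ (j - k))
          + ∑ h ∈ range (N + 1), y ^ (h + j + 1) * s ^ h * (1 - s * x))
        = - (∑ k ∈ range j, y ^ (k + 1 + 1) * x ^ (j - k))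
          + ∑ h ∈ range (N + 1), y ^ (h + (j + 1) + 1) * s ^ h * (1 - s * x) := by
      have h0 : y * (1 - q * y) = 0 := by rw [mul_sub, mul_one, ← mul_assoc, hyo, sub_self]
      rw [mul_add, mul_sub, ← mul_assoc, h0, zero_mul, zero_sub, mul_sum, mul_sum]
      simp_rw [← mul_assoc, ← pow_succ', add_assoc]
    set T := (1 - q * y) * (∑ h ∈ range (N + 1), q ^ h * x ^ (h + j + 1))
          - (∑ k ∈ range j, y ^ (k + 1) * x ^ (j - k))
          + ∑ h ∈ range (N + 1), y ^ (h + j + 1) * s ^ h * (1 - s * x) with hT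
    have e1 : (∑ h ∈ range (N + 1), q ^ h * x ^ (h + 1)) * T
        = ∑ h ∈ range (N + 1), q ^ h * x ^ (h + (j + 1) + 1) := by
      rw [sum_mul]
      refine sum_congr rfl fun h _ => ?_
      rw [pow_succ x h, mul_assoc, mul_assoc, key x hxq hxy, ← pow_succ', ← pow_add, add_assoc h]
    have e2 : (∑ h ∈ range (N + 1), y ^ (h + 1) * s ^ h * (1 - s * x)) * T
        = y * T - y * x ^ (j + 1) := by
      rw [sum_mul, sum_range_succ', sum_eq_zero, zero_add]
      · have h1 : s * x * T = x ^ (j + 1) := by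
          rw [mul_assoc, key x hxq hxy, ← pow_succ', mul_pow_add_two_of_outer hsx hxo]
        rw [mul_assoc, sub_mul, h1]
        simp [mul_sub]
      · intro h _
        rw [pow_succ s, mul_assoc, mul_assoc, mul_assoc (s ^ h), ← mul_assoc s, ← hps, mul_assoc,
          key s hsq hsy, pow_succ' x, ← mul_assoc s, hsx, mul_assoc, ← mul_assoc (1 - x * s),
          ← hsx, hpx]
        simp
    rw [add_mul, mul_assoc, e1, e2, hyT, sum_range_succ' _ j]
    simp only [Nat.add_sub_add_right, zero_add, pow_one, Nat.sub_zero]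
    abel

/-- The powers of `s + q` times its spectral idempotent at zero, when `s * q = 0`. -/
theorem add_pow_mul_one_sub_drazin_sum {s q x y : R} (hsq : s * q = 0) (hsy : s * y = 0)
    (hqy : q * y = y * q) (N j : ℕ) :
    (s + q) ^ j * (1 - (s + q) * ((1 - q * y) * ∑ h ∈ range (N + 1), q ^ h * x ^ (h + 1)
      + ∑ h ∈ range (N + 1), y ^ (h + 1) * s ^ h * (1 - s * x)))
    = (∑ k ∈ range (j + 1), q ^ k * s ^ (j - k) * (1 - s * x))
      - (1 - q * y) * (∑ h ∈ range (N + 1), q ^ (h + 1 + j) * x ^ (h + 1))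
      - ∑ h ∈ range (N + 1), q ^ (j + 1) * y ^ (h + 1) * s ^ h * (1 - s * x) := by
  have hcq : Commute q (1 - q * y) :=
    (Commute.one_right q).sub_right ((Commute.refl q).mul_right hqy)
  have e1 := mul_drazin_sum_of_mul_eq_zero (x := x) (z := 1 - s * x) hsq hsy s N 0
  simp only [add_zero, zero_add, pow_one] at e1
  have e2 : ∀ j, (s + q) ^ j * q = q ^ (j + 1) := by
    intro j
    induction j with
    | zero => simp
    | succ j ih => rw [pow_succ, mul_assoc, add_mul, hsq, zero_add, ← mul_assoc, ih, ← pow_succ]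
  have e3 : q ^ (j + 1) * ((1 - q * y) * ∑ h ∈ range (N + 1), q ^ h * x ^ (h + 1))
      = (1 - q * y) * (∑ h ∈ range (N + 1), q ^ (h + 1 + j) * x ^ (h + 1)) := by
    rw [← mul_assoc, (hcq.pow_left _).eq, mul_assoc, mul_sum]
    refine congrArg _ (sum_congr rfl fun h _ => ?_)
    rw [← mul_assoc, ← pow_add, show j + 1 + h = h + 1 + j by ring]
  rw [add_mul, e1, ← sub_sub, mul_sub, ← mul_assoc, e2, mul_add, e3, add_pow_of_mul_eq_zero hsq,
    sum_mul, mul_sum _ _ (q ^ (j + 1)), sub_sub]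
  simp only [mul_assoc]

/-- The powers of the Drazin inverse of `(1 - p * z) * (r + p)`. -/
theorem corner_drazin_sum_pow {p z w : R} (hwp : w * p = 0) (hwz : w * z = 0) (N j : ℕ) :
    ((1 - p * z) * ∑ i ∈ range (N + 1), p ^ i * w ^ (i + 1)) ^ (j + 1)
      = ∑ i ∈ range (N + 1), (1 - p * z) * p ^ i * w ^ (i + j + 1) := by
  have hw := mul_drazin_sum_of_mul_eq_zero (x := w) (z := (0 : R)) hwp hwz 0 N 0
  simp only [add_zero, zero_add, pow_one, mul_zero, sum_const_zero] at hw
  induction j with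
  | zero => simp [mul_sum, mul_assoc]
  | succ j ih =>
    rw [pow_succ, ih, sum_mul]
    refine sum_congr rfl fun i _ => ?_
    rw [pow_succ w (i + j), mul_assoc, mul_assoc (w ^ (i + j)), hw, ← mul_assoc (w ^ (i + j)),
      ← pow_succ, ← pow_succ, add_assoc i]

theorem mul_corner_pow {c p z r : R} (hrp : r * p = 0) (hcp : c * p = 0) (j : ℕ) :
    c * ((1 - p * z) * (r + p)) ^ j = c * r ^ j := by
  induction j generalizing c with
  | zero => simp
  | succ j ih =>
    have : c * ((1 - p * z) * (r + p)) = c * r := by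
      rw [← mul_assoc, mul_sub, mul_one, ← mul_assoc, hcp, zero_mul, sub_zero, mul_add, hcp, add_zero]
    rw [pow_succ', ← mul_assoc, this, ih (by rw [mul_assoc, hrp, mul_zero]), mul_assoc, ← pow_succ']

theorem one_sub_mul_self_of_outer {p z : R} (hzo : z * p * z = z) :
    (1 - p * z) * (1 - p * z) = 1 - p * z := by
  have : p * z * (p * z) = p * z := by rw [mul_assoc, ← mul_assoc z, hzo]
  rw [mul_sub, mul_one, sub_mul, this, one_mul, sub_self, sub_zero]

theorem mul_corner_pow_left {p z r : R} (hrp : r * p = 0) (hpz : p * z = z * p)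
    (hzo : z * p * z = z) (j : ℕ) :
    (1 - p * z) * ((1 - p * z) * (r + p)) ^ j = (1 - p * z) * (r + p) ^ j := by
  have hi := one_sub_mul_self_of_outer hzo
  have hcp : p * (1 - p * z) = (1 - p * z) * p :=
    (Commute.one_right p).sub_right ((Commute.refl p).mul_right hpz)
  induction j with
  | zero => simp
  | succ j ih =>
    have h : (1 - p * z) * (r + p) * (1 - p * z) = (1 - p * z) * (r + p) := by
      have h1 : r * (1 - p * z) = r := by
        rw [mul_sub, mul_one, ← mul_assoc, hrp, zero_mul, sub_zero]
      rw [mul_assoc, add_mul, h1, hcp, mul_add, ← mul_assoc, hi, mul_add]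
    rw [pow_succ', ← mul_assoc, ← mul_assoc, hi, ← h, mul_assoc _ (1 - p * z), h, ih, ← mul_assoc,
      h, mul_assoc, ← pow_succ']

/-- The spectral idempotent at zero of `(1 - p * z) * (r + p)`, times its powers. -/
theorem one_sub_mul_corner_pow {p z r w t : R} (hrp : r * p = 0) (hrz : r * z = 0)
    (hwp : w * p = 0) (hpz : p * z = z * p) (hzo : z * p * z = z)
    (hpt : p * t = 0) (N j : ℕ) :
    (1 - (1 - p * z) * (r + p) * ((1 - p * z) * ∑ i ∈ range (N + 1), p ^ i * w ^ (i + 1))) *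
      (((1 - p * z) * (r + p)) ^ j * t)
    = (1 - p * z) * ((∑ k ∈ Icc 1 j, p ^ k * r ^ (j - k)) + (1 - r * w) * r ^ j
        - ∑ i ∈ range (N + 1), p ^ (i + 1) * w ^ (i + 1) * r ^ j) * t := by
  have hi := one_sub_mul_self_of_outer hzo
  have hcp : p * (1 - p * z) = (1 - p * z) * p :=
    (Commute.one_right p).sub_right ((Commute.refl p).mul_right hpz)
  have hrs := mul_drazin_sum_of_mul_eq_zero (x := w) (z := (0 : R)) hrp hrz 0 N 0
  simp only [add_zero, zero_add, pow_one, mul_zero, sum_const_zero] at hrs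
  have e1 : (1 - p * z) * (r + p) * ((1 - p * z) * ∑ i ∈ range (N + 1), p ^ i * w ^ (i + 1))
      = (1 - p * z) * (r * w + ∑ i ∈ range (N + 1), p ^ (i + 1) * w ^ (i + 1)) := by
    rw [mul_assoc, add_mul, hrs, mul_add, ← mul_assoc p, hcp, mul_assoc _ p, ← mul_assoc _ _ (p * _),
      hi, mul_sum _ _ p, mul_add]
    simp only [← mul_assoc, ← pow_succ']
  have e2 : (r * w + ∑ i ∈ range (N + 1), p ^ (i + 1) * w ^ (i + 1)) * ((1 - p * z) * (r + p)) ^ j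
      = r * w * r ^ j + ∑ i ∈ range (N + 1), p ^ (i + 1) * w ^ (i + 1) * r ^ j := by
    rw [add_mul, mul_corner_pow hrp (by rw [mul_assoc, hwp, mul_zero]), sum_mul]
    congr 1
    refine sum_congr rfl fun i _ => mul_corner_pow hrp ?_ j
    rw [pow_succ w, mul_assoc, mul_assoc, hwp, mul_zero, mul_zero]
  have e3 : ((1 - p * z) * (r + p)) ^ j * t = (1 - p * z) * ((1 - p * z) * (r + p)) ^ j * t := by
    cases j with
    | zero => rw [pow_zero, mul_one, one_mul, sub_mul, hpz, mul_assoc, hpt]; simp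
    | succ j => rw [pow_succ', ← mul_assoc, ← mul_assoc, hi]
  have e4 : (r + p) ^ j = (∑ k ∈ Icc 1 j, p ^ k * r ^ (j - k)) + r ^ j := by
    rw [add_pow_of_mul_eq_zero hrp, sum_range_succ', sum_Icc_one_eq_sum_range]
    simp
  rw [sub_mul, one_mul, ← mul_assoc _ _ t, e1, mul_assoc (1 - p * z), e2, e3,
    mul_corner_pow_left hrp hpz hzo, e4, ← sub_mul _ _ t, ← mul_sub, sub_mul 1 (r * w),
    one_mul]
  congr 2
  abel
end Ring

section Matrix
variable {ι : Type*} [Fintype ι] [DecidableEq ι]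

theorem IsDrazinInverse.unique {A X Y : Matrix ι ι ℂ} (hX : IsDrazinInverse A X)
    (hY : IsDrazinInverse A Y) : X = Y := by
  obtain ⟨hXc, hXo, k, hXk⟩ := hX
  obtain ⟨hYc, hYo, n, hYn⟩ := hY
  have hl : ∀ j, X ^ (j + 1) * A ^ j = X := fun j => by
    induction j with
    | zero => simp
    | succ j ih => rw [pow_succ' A, ← mul_assoc, pow_add_two_mul_of_outer hXc hXo, ih]
  have hr : ∀ j, A ^ j * Y ^ (j + 1) = Y := fun j => by
    induction j with
    | zero => simp
    | succ j ih => rw [pow_succ A, mul_assoc, mul_pow_add_two_of_outer hYc hYo, ih]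
  have hXk' : X * A ^ (k + 1) = A ^ k := by
    rw [← ((show Commute A X from hXc).pow_left (k + 1)).eq, hXk]
  have h1 : X = X * A * Y :=
    calc X = X ^ (n + 1) * (A ^ (n + 1) * Y) := by rw [hYn, hl]
      _ = X ^ (n + 1) * A ^ n * A * Y := by simp only [pow_succ A, mul_assoc]
      _ = X * A * Y := by rw [hl]
  have h2 : Y = X * A * Y :=
    calc Y = X * A ^ (k + 1) * Y ^ (k + 1) := by rw [hXk', hr]
      _ = X * A * (A ^ k * Y ^ (k + 1)) := by simp only [pow_succ' A, mul_assoc]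
      _ = X * A * Y := by rw [hr]
  exact h1.trans h2.symm

/-- The Drazin inverse of `A + B` when `A * B = 0`. -/
theorem IsDrazinInverse.add_of_mul_eq_zero {A B X Y : Matrix ι ι ℂ} (hX : IsDrazinInverse A X)
    (hY : IsDrazinInverse B Y) (hAB : A * B = 0) {n : ℕ} (hn : 1 ≤ n)
    (hA : A ^ n * (1 - A * X) = 0) (hB : B ^ n * (1 - B * Y) = 0) :
    IsDrazinInverse (A + B) ((1 - B * Y) * ∑ j ∈ range n, B ^ j * X ^ (j + 1)
      + ∑ j ∈ range n, Y ^ (j + 1) * A ^ j * (1 - A * X)) := by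
  obtain ⟨N, rfl⟩ := Nat.exists_eq_add_of_le' hn
  obtain ⟨hXc, hXo, -⟩ := hX
  obtain ⟨hYc, hYo, -⟩ := hY
  have hXB := outer_mul_eq_zero hXc hXo hAB
  have hAY := mul_outer_eq_zero hYc hYo hAB
  have e1 := add_mul_drazin_sum (x := X) hAB hAY hYc hYo N hB
  have e2 := drazin_sum_mul_add hAB hXB hXc hXo hYc N hA
  refine ⟨e1.trans e2.symm, ?_, 2 * N + 2, ?_⟩
  · rw [e2, drazin_sum_idempotent_mul hAB hAY hXc hXo hYc hYo]
  · rw [pow_succ, mul_assoc, e1, add_pow_mul_drazin_sum hAB hAY N hB hA]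

/-- The Drazin inverse of `(1 - P * Z) * (R + P)` when `R * P = 0`. -/
theorem IsDrazinInverse.corner {P Z R W : Matrix ι ι ℂ} (hZ : IsDrazinInverse P Z)
    (hW : IsDrazinInverse R W) (hRP : R * P = 0) {m : ℕ} (hm : 1 ≤ m)
    (hR : R ^ m * (1 - R * W) = 0) (hP : P ^ m * (1 - P * Z) = 0) :
    IsDrazinInverse ((1 - P * Z) * (R + P))
      ((1 - P * Z) * ∑ i ∈ range m, P ^ i * W ^ (i + 1)) := by
  obtain ⟨hZc, hZo, -⟩ := hZ
  obtain ⟨hWc, hWo, -⟩ := hW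
  have hWP := outer_mul_eq_zero hWc hWo hRP
  have hi := one_sub_mul_self_of_outer hZo
  have hcp : P * (1 - P * Z) = (1 - P * Z) * P :=
    (Commute.one_right P).sub_right ((Commute.refl P).mul_right hZc)
  have hRE : R * (1 - P * Z) = R := by
    rw [mul_sub, mul_one, ← mul_assoc, hRP, zero_mul, sub_zero]
  have hWE : W * (1 - P * Z) = W := by
    rw [mul_sub, mul_one, ← mul_assoc, hWP, zero_mul, sub_zero]
  set E := 1 - P * Z with hE
  have hRpow : ∀ k, (E * R) ^ (k + 1) = E * R ^ (k + 1) := fun k => by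
    induction k with
    | zero => simp
    | succ k ih => rw [pow_succ, ih, pow_succ R (k + 1), mul_assoc, ← mul_assoc _ E,
        pow_succ R k, mul_assoc _ R E, hRE, mul_assoc]
  have hWpow : ∀ k, (E * W) ^ (k + 1) = E * W ^ (k + 1) := fun k => by
    induction k with
    | zero => simp
    | succ k ih => rw [pow_succ, ih, pow_succ W (k + 1), mul_assoc, ← mul_assoc _ E,
        pow_succ W k, mul_assoc _ W E, hWE, mul_assoc]
  have hPpow : ∀ k, (E * P) ^ k * E = E * P ^ k := fun k => by
    rw [(show Commute E P from hcp.symm).mul_pow, mul_assoc,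
      ← (show Commute E P from hcp.symm).pow_right k |>.eq, ← mul_assoc, ← pow_succ,
      (show IsIdempotentElem E from hi).pow_succ_eq]
  have hRW : E * R * (E * W) = E * (R * W) := by rw [mul_assoc, ← mul_assoc R, hRE]
  have hWR : E * W * (E * R) = E * (W * R) := by rw [mul_assoc, ← mul_assoc W, hWE]
  obtain ⟨M, rfl⟩ := Nat.exists_eq_add_of_le' hm
  have hA : (E * R) ^ (M + 1) * (1 - E * R * (E * W)) = 0 := by
    rw [hRpow, hRW, mul_sub, mul_one, ← mul_assoc _ E, mul_assoc E _ E, pow_succ R,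
      mul_assoc _ R E, hRE, ← pow_succ, mul_assoc, ← mul_sub]
    rw [mul_sub, mul_one] at hR
    rw [hR, mul_zero]
  have hPP : (E * P) ^ (M + 1) = 0 := by
    rw [(show Commute E P from hcp.symm).mul_pow,
      (show IsIdempotentElem E from hi).pow_succ_eq,
      ((show Commute E P from hcp.symm).pow_right _).eq, hP]
  have h := IsDrazinInverse.add_of_mul_eq_zero (A := E * R) (B := E * P) (X := E * W) (Y := 0)
    ⟨?_, ?_, M + 1, ?_⟩ ⟨by simp, by simp, M + 1, ?_⟩ ?_ hm hA (by rw [hPP, zero_mul])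
  · rw [← mul_add] at h
    convert h using 1
    simp only [mul_zero, sub_zero, one_mul, zero_pow (Nat.succ_ne_zero _), zero_mul,
      sum_const_zero, add_zero]
    rw [mul_sum]
    refine sum_congr rfl fun i _ => ?_
    rw [hWpow, ← mul_assoc (_ ^ i), hPpow, mul_assoc]
  · rw [hRW, hWR, hWc]
  · rw [hWR, mul_assoc, mul_assoc W, ← mul_assoc R, hRE, ← mul_assoc W, hWo]
  · rw [pow_succ, mul_assoc]
    rw [mul_sub, mul_one, sub_eq_zero] at hA
    exact hA.symm
  · rw [hPP, mul_zero]
  · rw [mul_assoc, ← mul_assoc R, hRE, hRP, mul_zero]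
end Matrix

theorem stmt_6 {d : ℕ} (P Q R S Pd Qd Rd Sd : Matrix (Fin d) (Fin d) ℂ)
    (hPQ : P * Q = 0) (hQP : Q * P = 0)
    (hPS : P * S = 0) (hSQ : S * Q = 0) (hQR : Q * R = 0) (hRP : R * P = 0)
    (hSP : S * P = 0) (hSR : S * R = 0)
    (hPd : IsDrazinInverse P Pd) (hQd : IsDrazinInverse Q Qd)
    (hRd : IsDrazinInverse R Rd) (hSd : IsDrazinInverse S Sd)
    (SQd : Matrix (Fin d) (Fin d) ℂ)
    (hSQd : IsDrazinInverse (S + Q) SQd)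
    (Ud : Matrix (Fin d) (Fin d) ℂ)
    (hUd : IsDrazinInverse ((1 - P * Pd) * (R + P)) Ud)
    (l m nn : ℕ) (hl : 1 ≤ l) (hm : 1 ≤ m) (hnn : 1 ≤ nn)
    -- `l ≥ max (ind S) (ind Q)`
    (hlS : S ^ l * (1 - S * Sd) = 0) (hlQ : Q ^ l * (1 - Q * Qd) = 0)
    -- `m ≥ max (ind R) (ind P)`
    (hmR : R ^ m * (1 - R * Rd) = 0) (hmP : P ^ m * (1 - P * Pd) = 0)
    -- `nn ≥ max (ind (S+Q)) (ind (Pπ (R+P)))`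
    (hnSQ : (S + Q) ^ nn * (1 - (S + Q) * SQd) = 0)
    (hnU : ((1 - P * Pd) * (R + P)) ^ nn *
      (1 - ((1 - P * Pd) * (R + P)) * Ud) = 0) :
    IsDrazinInverse ((S + Q) + (1 - P * Pd) * (R + P))
      ((∑ j ∈ Finset.range nn,
        (1 - P * Pd) *
          ((∑ k ∈ Finset.Icc 1 j, P ^ k * R ^ (j - k)) + (1 - R * Rd) * R ^ j
            - ∑ i ∈ Finset.range m, P ^ (i + 1) * Rd ^ (i + 1) * R ^ j) *
          ((1 - Q * Qd) * (∑ h ∈ Finset.range l, Q ^ h * Sd ^ (h + j + 1))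
            - (∑ k ∈ Finset.Icc 1 j, Qd ^ k * Sd ^ (j + 1 - k))
            + ∑ h ∈ Finset.range l, Qd ^ (h + j + 1) * S ^ h * (1 - S * Sd)))
      + ∑ j ∈ Finset.range nn, ∑ i ∈ Finset.range m,
        (1 - P * Pd) * P ^ i * Rd ^ (i + j + 1) *
          ((∑ k ∈ Finset.range (j + 1), Q ^ k * S ^ (j - k) * (1 - S * Sd))
            - (1 - Q * Qd) * (∑ h ∈ Finset.range l, Q ^ (h + 1 + j) * Sd ^ (h + 1))
            - ∑ h ∈ Finset.range l,
                Q ^ (j + 1) * Qd ^ (h + 1) * S ^ h * (1 - S * Sd))) := by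
  obtain ⟨L, rfl⟩ := Nat.exists_eq_add_of_le' hl
  obtain ⟨M, rfl⟩ := Nat.exists_eq_add_of_le' hm
  have hA := hSQd.unique (hSd.add_of_mul_eq_zero hQd hSQ hl hlS hlQ)
  have hU := hUd.unique (hPd.corner hRd hRP hm hmR hmP)
  obtain ⟨hPc, hPo, -⟩ := hPd
  obtain ⟨hQc, hQo, -⟩ := hQd
  obtain ⟨hRc, hRo, -⟩ := hRd
  obtain ⟨hSc, hSo, -⟩ := hSd
  have hSQd0 := mul_outer_eq_zero hQc hQo hSQ
  have hSdQ := outer_mul_eq_zero hSc hSo hSQ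
  have hSdQd := mul_outer_eq_zero hQc hQo hSdQ
  have hRPd := mul_outer_eq_zero hPc hPo hRP
  have hRdP := outer_mul_eq_zero hRc hRo hRP
  have hRdPd := mul_outer_eq_zero hPc hPo hRdP
  have hAU : (S + Q) * ((1 - P * Pd) * (R + P)) = 0 := by
    have h : (S + Q) * (1 - P * Pd) = S + Q := by
      rw [mul_sub, mul_one, ← mul_assoc, add_mul, hSP, hQP]
      simp
    rw [← mul_assoc, h, add_mul, mul_add, mul_add, hSR, hSP, hQR, hQP]
    simp
  have hPA : P * SQd = 0 :=
    mul_outer_eq_zero hSQd.1 hSQd.2.1 (by rw [mul_add, hPS, hPQ, add_zero])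
  convert hSQd.add_of_mul_eq_zero hUd hAU hnn hnSQ hnU using 1
  congr 1
  · rw [mul_sum]
    refine sum_congr rfl fun j _ => ?_
    have hPA' : P * SQd ^ (j + 1) = 0 := by rw [pow_succ', ← mul_assoc, hPA, zero_mul]
    rw [hU, one_sub_mul_corner_pow hRP hRPd hRdP hPc hPo hPA' M j, hA,
      drazin_sum_pow hSdQ hSdQd hSQ hSQd0 hSc hSo hQo L j]
  · refine sum_congr rfl fun j _ => ?_
    rw [hU, corner_drazin_sum_pow hRdP hRdPd, hA, mul_assoc,
      add_pow_mul_one_sub_drazin_sum hSQ hSQd0 hQc, sum_mul]
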